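/- Let G be a finite connected graph, w a vertex of G, and T a BFS-tree of G rooted at w. Then δ(G) ≤ 2·ρ_{w,T}(G) + 1 ≤ 8·δ(G) + 1. -/

import Mathlib

open SimpleGraph

noncomputable section

namespace HypPaper

variable {V : Type*}

/-- Gromov product `(y|z)_w = (d(y,w)+d(z,w)-d(y,z))/2`. -/
def gp (G : SimpleGraph V) (y z w : V) : ℝ :=
  ((G.dist y w : ℝ) + (G.dist z w : ℝ) - (G.dist y z : ℝ)) / 2

/-- `G` is `δ`-hyperbolic. -/
def IsDeltaHyp (G : SimpleGraph V) (δ : ℝ) : Prop :=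
  ∀ w x y z : V, gp G x y w ≥ min (gp G x z w) (gp G y z w) - δ

/-- The hyperbolicity `δ(G)`: least `δ ≥ 0` such that `G` is `δ`-hyperbolic. -/
def hyperbolicity (G : SimpleGraph V) : ℝ :=
  sInf {δ : ℝ | 0 ≤ δ ∧ IsDeltaHyp G δ}

/-- Pointed hyperbolicity `δ_w(G)` with respect to basepoint `w`. -/
def pointedHyp (G : SimpleGraph V) (w : V) : ℝ :=
  sInf {δ : ℝ | ∀ x y z : V, gp G x y w ≥ min (gp G x z w) (gp G y z w) - δ}

/-- A walk is a geodesic (shortest path) if its length equals the distance. -/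
def IsGeodesic (G : SimpleGraph V) {x y : V} (p : G.Walk x y) : Prop :=
  p.length = G.dist x y

/-- Thinness condition at corner `v` of a triangle, with sides `p : v → u` and `q : v → u'`. -/
def ThinCorner (G : SimpleGraph V) (δ : ℝ) {v u u' : V}
    (p : G.Walk v u) (q : G.Walk v u') : Prop :=
  ∀ a ∈ p.support, ∀ b ∈ q.support,
    G.dist v a = G.dist v b → (G.dist v a : ℝ) ≤ gp G u u' v →
    (G.dist a b : ℝ) ≤ δ

/-- A geodesic triangle with sides `p : x → y`, `q : y → z`, `r : z → x` is `δ`-thin. -/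
def TriangleThin (G : SimpleGraph V) (δ : ℝ) {x y z : V}
    (p : G.Walk x y) (q : G.Walk y z) (r : G.Walk z x) : Prop :=
  ThinCorner G δ p r.reverse ∧ ThinCorner G δ q p.reverse ∧ ThinCorner G δ r q.reverse

/-- Thinness `τ(G)`: least `δ` such that every geodesic triangle is `δ`-thin. -/
def thinness (G : SimpleGraph V) : ℝ :=
  sInf {δ : ℝ | ∀ (x y z : V) (p : G.Walk x y) (q : G.Walk y z) (r : G.Walk z x),
    IsGeodesic G p → IsGeodesic G q → IsGeodesic G r → TriangleThin G δ p q r}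

/-- The insize `max {d(y_z,z_y), d(z_x,x_z), d(x_y,y_x)}` of a geodesic triangle with
sides `p : x → y`, `q : y → z`, `r : z → x`. -/
def triInsize (G : SimpleGraph V) {x y z : V}
    (p : G.Walk x y) (q : G.Walk y z) (r : G.Walk z x) : ℝ :=
  max (G.dist (p.getVert ⌊gp G y z x⌋₊) (r.reverse.getVert ⌊gp G y z x⌋₊) : ℝ)
    (max (G.dist (q.getVert ⌊gp G z x y⌋₊) (p.reverse.getVert ⌊gp G z x y⌋₊) : ℝ)
      (G.dist (r.getVert ⌊gp G x y z⌋₊) (q.reverse.getVert ⌊gp G x y z⌋₊) : ℝ))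

/-- Insize `ι(G)`: least upper bound on insizes of geodesic triangles. -/
def insize (G : SimpleGraph V) : ℝ :=
  sInf {δ : ℝ | ∀ (x y z : V) (p : G.Walk x y) (q : G.Walk y z) (r : G.Walk z x),
    IsGeodesic G p → IsGeodesic G q → IsGeodesic G r → triInsize G p q r ≤ δ}

/-- A geodesic triangle with sides `p : x → y`, `q : y → z`, `r : z → x` is `δ`-slim. -/
def TriangleSlim (G : SimpleGraph V) (δ : ℝ) {x y z : V}
    (p : G.Walk x y) (q : G.Walk y z) (r : G.Walk z x) : Prop :=
  (∀ a ∈ p.support, ∃ b, (b ∈ q.support ∨ b ∈ r.support) ∧ (G.dist a b : ℝ) ≤ δ) ∧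
  (∀ a ∈ q.support, ∃ b, (b ∈ r.support ∨ b ∈ p.support) ∧ (G.dist a b : ℝ) ≤ δ) ∧
  (∀ a ∈ r.support, ∃ b, (b ∈ p.support ∨ b ∈ q.support) ∧ (G.dist a b : ℝ) ≤ δ)

/-- Slimness `ς(G)`: least `δ` such that every geodesic triangle is `δ`-slim. -/
def slimness (G : SimpleGraph V) : ℝ :=
  sInf {δ : ℝ | ∀ (x y z : V) (p : G.Walk x y) (q : G.Walk y z) (r : G.Walk z x),
    IsGeodesic G p → IsGeodesic G q → IsGeodesic G r → TriangleSlim G δ p q r}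

/-- The metric interval `I(u,v)`. -/
def interval (G : SimpleGraph V) (u v : V) : Set V :=
  {x | G.dist u x + G.dist x v = G.dist u v}

/-- Interval thinness `κ(G)`. -/
def intervalThinness (G : SimpleGraph V) : ℝ :=
  sInf {κ : ℝ | ∀ x y a b : V, a ∈ interval G x y → b ∈ interval G x y →
    G.dist x a = G.dist x b → (G.dist a b : ℝ) ≤ κ}

/-- A BFS-tree of `G` rooted at `w`: a spanning tree (encoded by its parent function)
in which the path from `w` to any vertex is a shortest path of `G`. -/
structure BFSTree (G : SimpleGraph V) (w : V) where
  parent : V → V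
  parent_root : parent w = w
  adj_parent : ∀ x, x ≠ w → G.Adj (parent x) x
  dist_parent : ∀ x, x ≠ w → G.dist w (parent x) + 1 = G.dist w x

/-- The vertex of the tree path `[w,x]_T` at distance `r` from the root `w`
(for `r ≤ d(w,x)`). -/
def treeVert (G : SimpleGraph V) {w : V} (T : BFSTree G w) (x : V) (r : ℕ) : V :=
  T.parent^[G.dist w x - r] x

/-- `v` lies on the tree path `[w,x]_T`. -/
def onRootPath (G : SimpleGraph V) {w : V} (T : BFSTree G w) (x v : V) : Prop :=
  ∃ i ≤ G.dist w x, v = T.parent^[i] x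

/-- The rooted insize `ρ_{w,T}(G) = max {d(x_y, y_x) : x, y ∈ V}`, where `x_y`, `y_x` are
the vertices of `[w,x]_T`, `[w,y]_T` at distance `⌊(x|y)_w⌋` from `w`. -/
def rootedInsize (G : SimpleGraph V) {w : V} (T : BFSTree G w) : ℝ :=
  sSup {ρ : ℝ | ∃ x y : V,
    ρ = (G.dist (treeVert G T x ⌊gp G x y w⌋₊) (treeVert G T y ⌊gp G x y w⌋₊) : ℝ)}

/-- The rooted thinness `μ_{w,T}(G)`. -/
def rootedThinness (G : SimpleGraph V) {w : V} (T : BFSTree G w) : ℝ :=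
  sSup {μ : ℝ | ∃ x y x' y' : V, onRootPath G T x x' ∧ onRootPath G T y y' ∧
    G.dist w x' = G.dist w y' ∧ (G.dist w x' : ℝ) ≤ gp G x y w ∧
    μ = (G.dist x' y' : ℝ)}


theorem gp_comm (G : SimpleGraph V) (x y w : V) : gp G x y w = gp G y x w := by
  rw [gp, gp, G.dist_comm (u := x) (v := y)]
  ring

theorem gp_nonneg {G : SimpleGraph V} (hG : G.Connected) (x y w : V) : 0 ≤ gp G x y w := by
  have h : (G.dist x y : ℝ) ≤ G.dist x w + G.dist w y := by exact_mod_cast hG.dist_triangle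
  rw [G.dist_comm (u := w)] at h
  rw [gp]
  linarith

theorem floor_gp_le {G : SimpleGraph V} (hG : G.Connected) (x y w : V) :
    (⌊gp G x y w⌋₊ : ℝ) ≤ gp G x y w :=
  Nat.floor_le (gp_nonneg hG x y w)

theorem floor_gp_le_dist {G : SimpleGraph V} (hG : G.Connected) (x y w : V) :
    ⌊gp G x y w⌋₊ ≤ G.dist w x := by
  have h : (G.dist y w : ℝ) ≤ G.dist y x + G.dist x w := by exact_mod_cast hG.dist_triangle
  rw [G.dist_comm (u := y) (v := x)] at h
  refine Nat.floor_le_of_le ?_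
  rw [gp, G.dist_comm (u := w)]
  linarith

/-- Gromov products are half-integers, so the floor loses at most `1/2`. -/
theorem gp_le_floor_add_half (G : SimpleGraph V) (x y w : V) :
    gp G x y w ≤ ⌊gp G x y w⌋₊ + 1 / 2 := by
  have h := Nat.lt_floor_add_one (gp G x y w)
  set k := ⌊gp G x y w⌋₊
  rw [gp] at h ⊢
  have h' : G.dist x w + G.dist y w < G.dist x y + 2 * k + 2 := by
    have : (G.dist x w + G.dist y w : ℝ) < G.dist x y + 2 * k + 2 := by linarith
    exact_mod_cast this
  have h'' : (G.dist x w + G.dist y w : ℝ) ≤ G.dist x y + 2 * k + 1 := by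
    exact_mod_cast Nat.lt_succ_iff.mp h'
  linarith

theorem dist_iterate_parent {G : SimpleGraph V} {w : V} (T : BFSTree G w) (x : V) (i : ℕ)
    (hi : i ≤ G.dist w x) : G.dist w (T.parent^[i] x) + i = G.dist w x := by
  induction i with
  | zero => simp
  | succ i ih =>
    have ih := ih (by omega)
    have hne : T.parent^[i] x ≠ w := by
      intro h
      rw [h, dist_self] at ih
      omega
    have := T.dist_parent _ hne
    rw [Function.iterate_succ_apply']
    omega

theorem dist_iterate_parent_le {G : SimpleGraph V} (hG : G.Connected) {w : V} (T : BFSTree G w)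
    (x : V) (i : ℕ) : G.dist x (T.parent^[i] x) ≤ i := by
  induction i with
  | zero => simp
  | succ i ih =>
    have h : G.dist (T.parent^[i] x) (T.parent (T.parent^[i] x)) ≤ 1 := by
      by_cases hw : T.parent^[i] x = w
      · simp [hw, T.parent_root]
      · exact (dist_eq_one_iff_adj.mpr (T.adj_parent _ hw).symm).le
    rw [Function.iterate_succ_apply']
    exact hG.dist_triangle.trans (Nat.add_le_add ih h)

theorem dist_root_treeVert {G : SimpleGraph V} {w : V} (T : BFSTree G w) {x : V} {r : ℕ}
    (hr : r ≤ G.dist w x) : G.dist w (treeVert G T x r) = r := by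
  have := dist_iterate_parent T x (G.dist w x - r) (Nat.sub_le _ _)
  rw [treeVert]
  omega

theorem dist_treeVert_add_le {G : SimpleGraph V} (hG : G.Connected) {w : V} (T : BFSTree G w)
    {x : V} {r : ℕ} (hr : r ≤ G.dist w x) :
    (G.dist x (treeVert G T x r) : ℝ) + r ≤ G.dist w x := by
  have := dist_iterate_parent_le hG T x (G.dist w x - r)
  rw [← treeVert] at this
  exact_mod_cast (by omega : G.dist x (treeVert G T x r) + r ≤ G.dist w x)

theorem dist_treeVert_treeVert_add_le {G : SimpleGraph V} (hG : G.Connected) {w : V}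
    (T : BFSTree G w) {x : V} {k l : ℕ} (hkl : k ≤ l) (hl : l ≤ G.dist w x) :
    (G.dist (treeVert G T x l) (treeVert G T x k) : ℝ) + k ≤ l := by
  have h : treeVert G T x k = T.parent^[l - k] (treeVert G T x l) := by
    rw [treeVert, treeVert, ← Function.iterate_add_apply]
    congr 1
    omega
  have := dist_iterate_parent_le hG T (treeVert G T x l) (l - k)
  rw [← h] at this
  exact_mod_cast
    (by omega : G.dist (treeVert G T x l) (treeVert G T x k) + k ≤ l)

theorem dist_le_rootedInsize [Finite V] (G : SimpleGraph V) {w : V} (T : BFSTree G w) (x y : V) :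
    (G.dist (treeVert G T x ⌊gp G x y w⌋₊) (treeVert G T y ⌊gp G x y w⌋₊) : ℝ) ≤
      rootedInsize G T := by
  refine le_csSup ?_ ⟨x, y, rfl⟩
  refine ((Set.finite_range fun p : V × V =>
    (G.dist (treeVert G T p.1 ⌊gp G p.1 p.2 w⌋₊) (treeVert G T p.2 ⌊gp G p.1 p.2 w⌋₊) : ℝ)).subset
      ?_).bddAbove
  rintro _ ⟨x, y, rfl⟩
  exact ⟨(x, y), rfl⟩

/-- Connect `x` to `y` by descending the tree path of `x`, jumping to the tree path of `z`,
descending it, and jumping to the tree path of `y`. -/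
theorem le_gp_of_gp_le [Finite V] {G : SimpleGraph V} (hG : G.Connected) {w : V}
    (T : BFSTree G w) {x y z : V} (h : gp G y z w ≤ gp G x z w) :
    gp G y z w - (rootedInsize G T + 1 / 2) ≤ gp G x y w := by
  have hxz := dist_le_rootedInsize G T x z
  have hzy := dist_le_rootedInsize G T z y
  have hk := gp_le_floor_add_half G y z w
  have hkl : ⌊gp G y z w⌋₊ ≤ ⌊gp G x z w⌋₊ := Nat.floor_le_floor h
  have hlx := floor_gp_le_dist hG x z w
  have hlz := floor_gp_le_dist hG z x w
  have hky := floor_gp_le_dist hG y z w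
  rw [gp_comm G z x] at hlz
  rw [gp_comm G z y] at hzy
  set k := ⌊gp G y z w⌋₊
  set l := ⌊gp G x z w⌋₊
  have h₁ := dist_treeVert_add_le hG T hlx
  have h₂ := dist_treeVert_treeVert_add_le hG T hkl hlz
  have h₃ := dist_treeVert_add_le hG T hky
  have h₄ : (G.dist x y : ℝ) ≤ G.dist x (treeVert G T x l) +
      (G.dist (treeVert G T x l) (treeVert G T z l) +
        (G.dist (treeVert G T z l) (treeVert G T z k) +
          (G.dist (treeVert G T z k) (treeVert G T y k) + G.dist (treeVert G T y k) y))) := by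
    exact_mod_cast hG.dist_triangle.trans <| Nat.add_le_add_left
      (hG.dist_triangle.trans <| Nat.add_le_add_left
        (hG.dist_triangle.trans <| Nat.add_le_add_left hG.dist_triangle _) _) _
  rw [G.dist_comm (u := treeVert G T y k) (v := y)] at h₄
  rw [gp.eq_def G x y w, G.dist_comm (u := x) (v := w), G.dist_comm (u := y) (v := w)]
  linarith

theorem min_gp_sub_le_gp [Finite V] {G : SimpleGraph V} (hG : G.Connected) {w : V}
    (T : BFSTree G w) (x y z : V) :
    min (gp G x z w) (gp G y z w) - (rootedInsize G T + 1 / 2) ≤ gp G x y w := by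
  rcases le_total (gp G y z w) (gp G x z w) with h | h
  · rw [min_eq_right h]
    exact le_gp_of_gp_le hG T h
  · rw [min_eq_left h, gp_comm G x y]
    exact le_gp_of_gp_le hG T h

/-- Changing the basepoint at most doubles the hyperbolicity constant. -/
theorem isDeltaHyp_two_mul {G : SimpleGraph V} {w : V} {δ : ℝ}
    (h : ∀ x y z : V, min (gp G x z w) (gp G y z w) - δ ≤ gp G x y w) :
    IsDeltaHyp G (2 * δ) := by
  intro v x y z
  have four_point : min (gp G x z w + gp G y v w) (gp G y z w + gp G x v w) - 2 * δ ≤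
      gp G x y w + gp G z v w := by
    have h₁ := h x y z
    have h₂ := h x y v
    have h₃ := h z v x
    have h₄ := h z v y
    rw [gp_comm G z x, gp_comm G v x] at h₃
    rw [gp_comm G z y, gp_comm G v y] at h₄
    grind
  have shift : ∀ a b, gp G a b v =
      gp G a b w - gp G a v w - gp G b v w + G.dist v w := by
    intro a b
    simp only [gp]
    ring
  rw [shift x y, shift x z, shift y z]
  grind

theorem isDeltaHyp_rootedInsize [Finite V] {G : SimpleGraph V} (hG : G.Connected) {w : V}
    (T : BFSTree G w) : IsDeltaHyp G (2 * rootedInsize G T + 1) := by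
  have h := isDeltaHyp_two_mul (min_gp_sub_le_gp hG T)
  rwa [mul_add, mul_one_div_cancel two_ne_zero] at h

theorem rootedInsize_nonneg (G : SimpleGraph V) {w : V} (T : BFSTree G w) :
    0 ≤ rootedInsize G T := by
  refine Real.sSup_nonneg ?_
  rintro _ ⟨x, y, rfl⟩
  exact Nat.cast_nonneg _

theorem le_gp_treeVert {G : SimpleGraph V} (hG : G.Connected) {w : V} (T : BFSTree G w)
    {x : V} {r : ℕ} (hr : r ≤ G.dist w x) : (r : ℝ) ≤ gp G (treeVert G T x r) x w := by
  have h := dist_treeVert_add_le hG T hr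
  rw [gp, G.dist_comm (v := w), dist_root_treeVert T hr, G.dist_comm (u := x) (v := w),
    G.dist_comm (v := x) (u := treeVert G T x r)]
  linarith

theorem rootedInsize_le_of_isDeltaHyp {G : SimpleGraph V} (hG : G.Connected) {w : V}
    (T : BFSTree G w) {δ : ℝ} (hδ : 0 ≤ δ) (h : IsDeltaHyp G δ) : rootedInsize G T ≤ 4 * δ := by
  refine Real.sSup_le ?_ (by linarith)
  rintro _ ⟨x, y, rfl⟩
  have hr := floor_gp_le hG x y w
  have hx := floor_gp_le_dist hG x y w
  have hy := floor_gp_le_dist hG y x w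
  rw [gp_comm G y x] at hy
  set r := ⌊gp G x y w⌋₊
  have h₁ := h w (treeVert G T x r) y x
  have h₂ := h w (treeVert G T x r) (treeVert G T y r) y
  have hxr := le_gp_treeVert hG T hx
  have hyr := le_gp_treeVert hG T hy
  rw [gp_comm G y x] at h₁
  have h₃ : (r : ℝ) - 2 * δ ≤ gp G (treeVert G T x r) (treeVert G T y r) w := by grind
  rw [gp, G.dist_comm (v := w), dist_root_treeVert T hx, G.dist_comm (v := w),
    dist_root_treeVert T hy] at h₃
  linarith

/-- `δ(G) ≤ 2·ρ_{w,T}(G) + 1 ≤ 8·δ(G) + 1`. -/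
theorem hyperbolicity_approx_rootedInsize
    {V : Type*} [Fintype V] (G : SimpleGraph V) (hG : G.Connected)
    (w : V) (T : BFSTree G w) :
    hyperbolicity G ≤ 2 * rootedInsize G T + 1 ∧
      2 * rootedInsize G T + 1 ≤ 8 * hyperbolicity G + 1 := by
  have hnonneg : 0 ≤ 2 * rootedInsize G T + 1 := by linarith [rootedInsize_nonneg G T]
  have hmem := And.intro hnonneg (isDeltaHyp_rootedInsize hG T)
  refine ⟨csInf_le ⟨0, fun _ hδ => hδ.1⟩ hmem, ?_⟩
  have h : rootedInsize G T / 4 ≤ hyperbolicity G := by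
    refine le_csInf ⟨_, hmem⟩ fun δ hδ => ?_
    linarith [rootedInsize_le_of_isDeltaHyp hG T hδ.1 hδ.2]
  linarith

end HypPaper
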